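/- arXiv:2512.19060 — 7 statements merged into one kernel-verified Lean document; each statement's English description precedes it below -/
import Mathlib

section
/- For all natural numbers ℓ, h, m, i with ℓ ≤ h and m ≤ i, and for every x ∈ ℕ, the composition of the step functions satisfies: [m,i]([ℓ,h](x)) = [m,i](x) if h+2 ≤ m; [m,i]([ℓ,h](x)) = [ℓ,i](x) if h+1 = m; [m,i]([ℓ,h](x)) = [0,i](x) if m ≤ h and h ≤ i; and [m,i]([ℓ,h](x)) = [ℓ,h](x) if i < h. In particular, the family of functions [ℓ,h] (ℓ ≤ h) is closed under composition. -/
/-- The step function [ℓ,h] : ℕ → ℕ. -/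
def step (l h : ℕ) (x : ℕ) : ℕ :=
  if x < l then h else if x ≤ h then h + 1 else x

theorem step_composition (l h m i : ℕ) (hlh : l ≤ h) (hmi : m ≤ i) :
    (∀ x : ℕ,
      (h + 2 ≤ m → step m i (step l h x) = step m i x) ∧
      (h + 1 = m → step m i (step l h x) = step l i x) ∧
      (m ≤ h → h ≤ i → step m i (step l h x) = step 0 i x) ∧
      (i < h → step m i (step l h x) = step l h x)) ∧
    (∃ l' h' : ℕ, l' ≤ h' ∧ ∀ x : ℕ, step m i (step l h x) = step l' h' x) := by
  have key : ∀ x : ℕ,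
      (h + 2 ≤ m → step m i (step l h x) = step m i x) ∧
      (h + 1 = m → step m i (step l h x) = step l i x) ∧
      (m ≤ h → h ≤ i → step m i (step l h x) = step 0 i x) ∧
      (i < h → step m i (step l h x) = step l h x) := by
    intro x
    unfold step
    refine ⟨?_, ?_, ?_, ?_⟩ <;> intros <;> split_ifs <;> omega
  refine ⟨key, ?_⟩
  obtain hm | hm | hm : h + 2 ≤ m ∨ h + 1 = m ∨ m ≤ h := by omega
  · exact ⟨m, i, hmi, fun x => (key x).1 hm⟩
  · exact ⟨l, i, by omega, fun x => (key x).2.1 hm⟩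
  · obtain hi | hi := le_or_gt h i
    · exact ⟨0, i, Nat.zero_le i, fun x => (key x).2.2.1 hm hi⟩
    · exact ⟨l, h, hlh, fun x => (key x).2.2.2 hi⟩
end

section
/- For every binary context c that is not the bare hole (i.e., c contains at least one internal node), there exist natural numbers ℓ and h with ℓ ≤ h such that for every x ∈ ℕ one has stC(c)(x) = [ℓ,h](x). Equivalently, for every such context c there exist ℓ ≤ h such that for every binary tree t, st(c[t]) = [ℓ,h](st(t)). -/
/-- The Strahler operation. -/
def strahlerOp (x y : ℕ) : ℕ := if x = y then x + 1 else max x y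

/-- Binary trees. -/
inductive BinTree : Type
  | leaf : BinTree
  | node : BinTree → BinTree → BinTree

/-- The Strahler number of a binary tree. -/
def st : BinTree → ℕ
  | .leaf => 0
  | .node t₁ t₂ => strahlerOp (st t₁) (st t₂)

/-- Binary contexts. -/
inductive Ctx : Type
  | hole : Ctx
  | nodeL : Ctx → BinTree → Ctx
  | nodeR : BinTree → Ctx → Ctx

/-- Substitution of a tree for the hole of a context. -/
def subst : Ctx → BinTree → BinTree
  | .hole, t => t
  | .nodeL c u, t => .node (subst c t) u
  | .nodeR u c, t => .node u (subst c t)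

/-- The unary function on ℕ induced by a context in the Strahler algebra. -/
def stC : Ctx → ℕ → ℕ
  | .hole, x => x
  | .nodeL c u, x => strahlerOp (stC c x) (st u)
  | .nodeR u c, x => strahlerOp (st u) (stC c x)

theorem strahlerOp_comm (x y : ℕ) : strahlerOp x y = strahlerOp y x := by
  unfold strahlerOp
  grind

theorem strahlerOp_eq_step (x n : ℕ) : strahlerOp x n = step n n x := by
  unfold strahlerOp step
  grind

theorem exists_strahlerOp_step (l h n : ℕ) (hlh : l ≤ h) :
    ∃ l' h' : ℕ, l' ≤ h' ∧ ∀ x, strahlerOp (step l h x) n = step l' h' x := by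
  unfold strahlerOp step
  rcases lt_trichotomy n h with hn | rfl | hn
  · exact ⟨l, h, hlh, by grind⟩
  · exact ⟨0, n, Nat.zero_le n, by grind⟩
  · rcases Nat.eq_or_lt_of_le (Nat.succ_le_of_lt hn) with rfl | hn'
    · exact ⟨l, h + 1, by omega, by grind⟩
    · exact ⟨n, n, le_rfl, by grind⟩

theorem st_subst (c : Ctx) (t : BinTree) : st (subst c t) = stC c (st t) := by
  induction c <;> simp_all [st, subst, stC]

theorem exists_strahlerOp_stC (c : Ctx) (n : ℕ)
    (ih : c ≠ Ctx.hole → ∃ l h : ℕ, l ≤ h ∧ ∀ x, stC c x = step l h x) :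
    ∃ l h : ℕ, l ≤ h ∧ ∀ x, strahlerOp (stC c x) n = step l h x := by
  by_cases hc : c = Ctx.hole
  · subst hc
    exact ⟨n, n, le_rfl, fun x => strahlerOp_eq_step x n⟩
  · obtain ⟨l, h, hlh, hstep⟩ := ih hc
    simpa only [hstep] using exists_strahlerOp_step l h n hlh

theorem exists_stC_eq_step (c : Ctx) (hc : c ≠ Ctx.hole) :
    ∃ l h : ℕ, l ≤ h ∧ ∀ x, stC c x = step l h x := by
  induction c with
  | hole => exact absurd rfl hc
  | nodeL c u ih => exact exists_strahlerOp_stC c (st u) ih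
  | nodeR u c ih =>
    simpa only [stC, strahlerOp_comm (st u)] using exists_strahlerOp_stC c (st u) ih

theorem stC_eq_step (c : Ctx) (hc : c ≠ Ctx.hole) :
    ∃ l h : ℕ, l ≤ h ∧ (∀ x : ℕ, stC c x = step l h x) ∧
      (∀ t : BinTree, st (subst c t) = step l h (st t)) := by
  obtain ⟨l, h, hlh, hstep⟩ := exists_stC_eq_step c hc
  exact ⟨l, h, hlh, hstep, fun t => (st_subst c t).trans (hstep (st t))⟩
end

section
/- Let N be a finite type and let t be an N-labeled binary tree such that for every internal node of t with label A and child subtrees t₁ and t₂, the label A does not occur both in t₁ and in t₂. Then the Strahler number of (the underlying binary tree of) t is at most the cardinality of N. -/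
/-- N-labeled binary trees. -/
inductive LTree (N : Type*) : Type _
  | lleaf : N → LTree N
  | lnode : N → LTree N → LTree N → LTree N

/-- The Strahler number of a labeled binary tree (of its underlying binary tree). -/
def lst {N : Type*} : LTree N → ℕ
  | .lleaf _ => 0
  | .lnode _ t₁ t₂ => strahlerOp (lst t₁) (lst t₂)

/-- A label occurs in a labeled tree if it is the label of some node. -/
def occurs {N : Type*} (A : N) : LTree N → Prop
  | .lleaf B => A = B
  | .lnode B t₁ t₂ => A = B ∨ occurs A t₁ ∨ occurs A t₂

/-- At every internal node, the label of the node does not occur in both child subtrees. -/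
def noDoubleOccurrence {N : Type*} : LTree N → Prop
  | .lleaf _ => True
  | .lnode A t₁ t₂ =>
      ¬(occurs A t₁ ∧ occurs A t₂) ∧ noDoubleOccurrence t₁ ∧ noDoubleOccurrence t₂

theorem lst_lt_card_of_occurs_mem {N : Type*} (t : LTree N) (ht : noDoubleOccurrence t)
    (S : Finset N) (hS : ∀ A, occurs A t → A ∈ S) : lst t < S.card := by
  classical
  induction t generalizing S with
  | lleaf B => exact Finset.card_pos.mpr ⟨B, hS B rfl⟩
  | lnode B t₁ t₂ ih₁ ih₂ =>
    obtain ⟨hB, h₁, h₂⟩ := ht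
    have hS₁ : ∀ A, occurs A t₁ → A ∈ S := fun A h => hS A (.inr (.inl h))
    have hS₂ : ∀ A, occurs A t₂ → A ∈ S := fun A h => hS A (.inr (.inr h))
    have hcard := Finset.card_erase_add_one (hS B (.inl rfl))
    have i₁ := ih₁ h₁ S hS₁
    have i₂ := ih₂ h₂ S hS₂
    simp only [lst, strahlerOp]
    split_ifs with heq
    · by_cases hB₁ : occurs B t₁
      · have := ih₂ h₂ (S.erase B) fun A h =>
          Finset.mem_erase.mpr ⟨fun e => hB ⟨hB₁, e ▸ h⟩, hS₂ A h⟩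
        omega
      · have := ih₁ h₁ (S.erase B) fun A h =>
          Finset.mem_erase.mpr ⟨fun e => hB₁ (e ▸ h), hS₁ A h⟩
        omega
    · exact max_lt i₁ i₂

theorem lst_le_card {N : Type*} [Fintype N] (t : LTree N)
    (ht : noDoubleOccurrence t) : lst t ≤ Fintype.card N := by
  exact (lst_lt_card_of_occurs_mem t ht Finset.univ fun A _ => Finset.mem_univ A).le
end

section
/- Let N be a set of nonterminals and P a set of productions of the forms A → ε and A → BC (A, B, C ∈ N). Suppose there exists a derivation tree t for a nonterminal A (with respect to P) that contains two occurrences of nodes labeled A at incomparable positions (neither node is an ancestor of the other). Then for every k ∈ ℕ there exists a derivation tree for A whose Strahler number is at least k; i.e., the Strahler numbers of derivation trees for A are unbounded. -/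
/-- Derivation trees of a CNF grammar, given by the set `Peps` of nonterminals `A` with a
production `A → ε` and the set `Pbin` of triples `(A, B, C)` with a production `A → BC`. -/
inductive Deriv {N : Type*} (Peps : Set N) (Pbin : Set (N × N × N)) :
    LTree N → N → Prop
  | leaf {A : N} : A ∈ Peps → Deriv Peps Pbin (.lleaf A) A
  | node {A B C : N} {t₁ t₂ : LTree N} : (A, B, C) ∈ Pbin →
      Deriv Peps Pbin t₁ B → Deriv Peps Pbin t₂ C →
      Deriv Peps Pbin (.lnode A t₁ t₂) A

/-- The subtree relation on labeled binary trees. -/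
inductive IsSubtree {N : Type*} : LTree N → LTree N → Prop
  | refl (t : LTree N) : IsSubtree t t
  | left {s t₁ t₂ : LTree N} {A : N} : IsSubtree s t₁ → IsSubtree s (.lnode A t₁ t₂)
  | right {s t₁ t₂ : LTree N} {A : N} : IsSubtree s t₂ → IsSubtree s (.lnode A t₁ t₂)

theorem le_strahlerOp_left (x y : ℕ) : x ≤ strahlerOp x y := by
  unfold strahlerOp; split_ifs <;> omega

theorem le_strahlerOp_right (x y : ℕ) : y ≤ strahlerOp x y := by
  unfold strahlerOp; split_ifs <;> omega

theorem succ_le_strahlerOp {k x y : ℕ} (hx : k ≤ x) (hy : k ≤ y) : k + 1 ≤ strahlerOp x y := by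
  unfold strahlerOp; split_ifs <;> omega

/-- Replacing an occurrence of `A` by a derivation tree `s` for `A` gives a derivation tree
whose Strahler number is at least that of `s`. -/
theorem Deriv.exists_lst_le_of_occurs {N : Type*} {Peps : Set N} {Pbin : Set (N × N × N)}
    {A B : N} {s u : LTree N} (hs : Deriv Peps Pbin s A) (hu : Deriv Peps Pbin u B)
    (hA : occurs A u) : ∃ u', Deriv Peps Pbin u' B ∧ lst s ≤ lst u' := by
  induction hu with
  | leaf _ =>
    obtain rfl : A = _ := hA
    exact ⟨s, hs, le_rfl⟩
  | node hp h₁ h₂ ih₁ ih₂ =>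
    rcases hA with rfl | hA | hA
    · exact ⟨s, hs, le_rfl⟩
    · obtain ⟨u', hu', hle⟩ := ih₁ hA
      exact ⟨_, .node hp hu' h₂, hle.trans (le_strahlerOp_left _ _)⟩
    · obtain ⟨u', hu', hle⟩ := ih₂ hA
      exact ⟨_, .node hp h₁ hu', hle.trans (le_strahlerOp_right _ _)⟩

/-- A subtree of a derivation tree is a derivation tree, and replacing it by another derivation
tree `v` for the same nonterminal gives a derivation tree whose Strahler number is at least
that of `v`. -/
theorem IsSubtree.exists_deriv {N : Type*} {Peps : Set N} {Pbin : Set (N × N × N)}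
    {A : N} {s t : LTree N} (hst : IsSubtree s t) (ht : Deriv Peps Pbin t A) :
    ∃ B, Deriv Peps Pbin s B ∧
      ∀ v, Deriv Peps Pbin v B → ∃ t', Deriv Peps Pbin t' A ∧ lst v ≤ lst t' := by
  induction hst generalizing A with
  | refl => exact ⟨A, ht, fun v hv => ⟨v, hv, le_rfl⟩⟩
  | left _ ih =>
    cases ht with
    | node hp h₁ h₂ =>
      obtain ⟨B, hB, hrepl⟩ := ih h₁
      refine ⟨B, hB, fun v hv => ?_⟩
      obtain ⟨t', ht', hle⟩ := hrepl v hv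
      exact ⟨_, .node hp ht' h₂, hle.trans (le_strahlerOp_left _ _)⟩
  | right _ ih =>
    cases ht with
    | node hp h₁ h₂ =>
      obtain ⟨B, hB, hrepl⟩ := ih h₂
      refine ⟨B, hB, fun v hv => ?_⟩
      obtain ⟨t', ht', hle⟩ := hrepl v hv
      exact ⟨_, .node hp h₁ ht', hle.trans (le_strahlerOp_right _ _)⟩

theorem unbounded_strahler_of_incomparable_occurrences {N : Type*}
    (Peps : Set N) (Pbin : Set (N × N × N)) (A : N)
    (h : ∃ t : LTree N, Deriv Peps Pbin t A ∧
      ∃ (B : N) (u₁ u₂ : LTree N), IsSubtree (.lnode B u₁ u₂) t ∧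
        occurs A u₁ ∧ occurs A u₂) :
    ∀ k : ℕ, ∃ t : LTree N, Deriv Peps Pbin t A ∧ k ≤ lst t := by
  obtain ⟨t, ht, B, u₁, u₂, hsub, hA₁, hA₂⟩ := h
  obtain ⟨C, hC, hrepl⟩ := hsub.exists_deriv ht
  cases hC with
  | node hp h₁ h₂ =>
    intro k
    induction k with
    | zero => exact ⟨t, ht, Nat.zero_le _⟩
    | succ k ih =>
      obtain ⟨s, hs, hk⟩ := ih
      obtain ⟨v₁, hv₁, hle₁⟩ := hs.exists_lst_le_of_occurs h₁ hA₁
      obtain ⟨v₂, hv₂, hle₂⟩ := hs.exists_lst_le_of_occurs h₂ hA₂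
      obtain ⟨t', ht', hle⟩ := hrepl _ (.node hp hv₁ hv₂)
      exact ⟨t', ht', (succ_le_strahlerOp (hk.trans hle₁) (hk.trans hle₂)).trans hle⟩
end

section
/- Let φ be a monotone Boolean formula in which every leaf is at depth exactly d (depth-uniform of depth d). Then the Strahler-algebra value V(φ) of its translation satisfies: V(φ) = 2d + 1 if φ evaluates to true, and V(φ) = 2d if φ evaluates to false. -/
/-- Monotone Boolean formulas. -/
inductive MBF : Type
  | tt : MBF
  | ff : MBF
  | and : MBF → MBF → MBF
  | or : MBF → MBF → MBF

/-- Boolean evaluation of a monotone Boolean formula. -/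
def MBF.eval : MBF → Bool
  | .tt => true
  | .ff => false
  | .and φ ψ => φ.eval && ψ.eval
  | .or φ ψ => φ.eval || ψ.eval

/-- Depth-uniformity: every leaf is at depth exactly `d`. -/
def MBF.uniform : ℕ → MBF → Prop
  | 0, .tt => True
  | 0, .ff => True
  | d + 1, .and φ ψ => φ.uniform d ∧ ψ.uniform d
  | d + 1, .or φ ψ => φ.uniform d ∧ ψ.uniform d
  | _, _ => False

/-- The Strahler-algebra value of the translation of a monotone Boolean formula. -/
def MBF.val : MBF → ℕ
  | .tt => 1
  | .ff => 0
  | .and φ ψ =>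
      strahlerOp (strahlerOp φ.val φ.val) (strahlerOp ψ.val ψ.val)
  | .or φ ψ =>
      strahlerOp (strahlerOp (strahlerOp φ.val φ.val) ψ.val)
        (strahlerOp φ.val (strahlerOp ψ.val ψ.val))

/-- The value of a depth-uniform formula is twice its depth plus its truth value. -/
theorem MBF.val_eq_add_toNat_eval {d : ℕ} {φ : MBF} (h : φ.uniform d) :
    φ.val = 2 * d + φ.eval.toNat := by
  induction φ generalizing d with
  | tt => cases d <;> simp_all [MBF.uniform, MBF.val, MBF.eval]
  | ff => cases d <;> simp_all [MBF.uniform, MBF.val, MBF.eval]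
  | and φ ψ ihφ ihψ =>
    cases d with
    | zero => simp [MBF.uniform] at h
    | succ d =>
      obtain ⟨hφ, hψ⟩ := h
      rw [MBF.val, MBF.eval, ihφ hφ, ihψ hψ]
      cases φ.eval <;> cases ψ.eval <;> simp [strahlerOp] <;> grind
  | or φ ψ ihφ ihψ =>
    cases d with
    | zero => simp [MBF.uniform] at h
    | succ d =>
      obtain ⟨hφ, hψ⟩ := h
      rw [MBF.val, MBF.eval, ihφ hφ, ihψ hψ]
      cases φ.eval <;> cases ψ.eval <;> simp [strahlerOp] <;> grind

theorem val_of_uniform (d : ℕ) (φ : MBF) (h : φ.uniform d) :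
    (φ.eval = true → φ.val = 2 * d + 1) ∧ (φ.eval = false → φ.val = 2 * d) := by
  constructor <;> intro he <;> simp [MBF.val_eq_add_toNat_eval h, he]
end

section
/- For every natural number k and every binary tree t: Emb(k, t) holds if and only if st(t) ≥ k. Consequently, the Strahler number of t is the largest k such that the complete binary tree of depth k embeds into t with tree edges mapped to nonempty paths. -/
/-- `Emb k t` expresses that the complete binary tree of depth `k` embeds into `t`,
edges being mapped to nonempty paths. -/
def Emb : ℕ → BinTree → Prop
  | 0, _ => True
  | _ + 1, .leaf => False
  | k + 1, .node t₁ t₂ => (Emb k t₁ ∧ Emb k t₂) ∨ Emb (k + 1) t₁ ∨ Emb (k + 1) t₂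

theorem succ_le_strahlerOp_iff (k x y : ℕ) :
    k + 1 ≤ strahlerOp x y ↔ (k ≤ x ∧ k ≤ y) ∨ k + 1 ≤ x ∨ k + 1 ≤ y := by
  unfold strahlerOp
  split_ifs <;> omega

theorem emb_iff_le_st (k : ℕ) (t : BinTree) : Emb k t ↔ k ≤ st t := by
  induction t generalizing k with
  | leaf => cases k <;> simp [Emb, st]
  | node t₁ t₂ ih₁ ih₂ =>
    cases k with
    | zero => simp [Emb]
    | succ k => simp only [Emb, st, succ_le_strahlerOp_iff, ih₁, ih₂]

theorem emb_iff_st_ge :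
    (∀ (k : ℕ) (t : BinTree), Emb k t ↔ k ≤ st t) ∧
    (∀ t : BinTree, IsGreatest {k : ℕ | Emb k t} (st t)) := by
  exact ⟨emb_iff_le_st, fun t => ⟨(emb_iff_le_st _ t).2 le_rfl, fun k h => (emb_iff_le_st k t).1 h⟩⟩
end

section
/- For all binary contexts c, c₁, c₂ and all binary trees t₁, t₂: st( c[ node( c₁[t₁], c₂[t₂] ) ] ) ≥ min(st(t₁), st(t₂)) + 1. In other words, if a binary tree contains two subtrees at incomparable positions whose Strahler numbers are both at least s, then the whole tree has Strahler number at least s+1. -/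
theorem max_le_strahlerOp (x y : ℕ) : max x y ≤ strahlerOp x y := by
  unfold strahlerOp
  split_ifs <;> omega

theorem min_add_one_le_strahlerOp (x y : ℕ) : min x y + 1 ≤ strahlerOp x y := by
  unfold strahlerOp
  split_ifs <;> omega

theorem st_le_st_subst (c : Ctx) (t : BinTree) : st t ≤ st (subst c t) := by
  induction c with
  | hole => exact le_rfl
  | nodeL c u ih => exact ih.trans ((le_max_left _ _).trans (max_le_strahlerOp _ _))
  | nodeR u c ih => exact ih.trans ((le_max_right _ _).trans (max_le_strahlerOp _ _))

theorem st_incomparable_subtrees (c c₁ c₂ : Ctx) (t₁ t₂ : BinTree) :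
    min (st t₁) (st t₂) + 1 ≤
      st (subst c (BinTree.node (subst c₁ t₁) (subst c₂ t₂))) := by
  calc
    min (st t₁) (st t₂) + 1 ≤ min (st (subst c₁ t₁)) (st (subst c₂ t₂)) + 1 := by
      gcongr <;> exact st_le_st_subst _ _
    _ ≤ st (BinTree.node (subst c₁ t₁) (subst c₂ t₂)) := min_add_one_le_strahlerOp _ _
    _ ≤ _ := st_le_st_subst _ _
end
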